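/- Let $R \to R'$ be a faithfully flat homomorphism of commutative rings, let $X$ and $Y$ be $R$-schemes, and let $f \colon X \to Y$ be an $R$-morphism. If the base change $f' = f \times_{\operatorname{Spec} R} \operatorname{Spec} R' \colon X \times_{\operatorname{Spec} R} \operatorname{Spec} R' \to Y \times_{\operatorname{Spec} R} \operatorname{Spec} R'$ is a closed immersion, then $f$ is a closed immersion. -/

import Mathlib

open AlgebraicGeometry CategoryTheory CategoryTheory.Limits

universe u

open MorphismProperty in
/-- Being a closed immersion satisfies fpqc descent. -/
lemma closedImmersion_descendsAlong_aux :
    DescendsAlong @IsClosedImmersion.{u} (@Surjective ⊓ @Flat ⊓ @QuasiCompact) := by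
  have hsc : (@Surjective ⊓ @Flat : MorphismProperty Scheme.{u}).IsStableUnderComposition :=
    ⟨fun f g hf hg ↦ by
      obtain ⟨_, _⟩ : Surjective f ∧ Flat f := hf
      obtain ⟨_, _⟩ : Surjective g ∧ Flat g := hg
      exact ⟨(inferInstance : Surjective (f ≫ g)), (inferInstance : Flat (f ≫ g))⟩⟩
  have hid : ContainsIdentities @Flat.{u} := ⟨fun X ↦ (inferInstance : Flat (𝟙 X))⟩
  have hzs : IsZariskiLocalAtSource @Flat.{u} :=
    HasRingHomProperty.instIsZariskiLocalAtSource (P := @Flat) (Q := RingHom.Flat)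
  have hsb : (@Surjective ⊓ @Flat : MorphismProperty Scheme.{u}).IsStableUnderBaseChange :=
    ⟨fun hpb hg ↦ ⟨of_isPullback (P := @Surjective) hpb hg.1,
      of_isPullback (P := @Flat) hpb hg.2⟩⟩
  apply IsZariskiLocalAtTarget.descendsAlong_inf_quasiCompact
  · intro X Y f hf
    exact ⟨hf.2, (have := hid; IsLocalIso.le_of_isZariskiLocalAtSource @Flat.{u} _ _ _ hf.1)⟩
  intro R S Y φ g h hfst
  have hQ : (@Surjective ⊓ @Flat ⊓ @QuasiCompact : MorphismProperty Scheme.{u}) (Spec.map φ) :=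
    ⟨h, inferInstance⟩
  have : IsAffine Y :=
    have : UniversallyInjective g :=
      of_pullback_fst_of_descendsAlong (P := @UniversallyInjective) (f := Spec.map φ)
        (Q := @Surjective ⊓ @Flat ⊓ @QuasiCompact) hQ inferInstance
    have : UniversallyClosed g :=
      of_pullback_fst_of_descendsAlong (P := @UniversallyClosed) (f := Spec.map φ)
        (Q := @Surjective ⊓ @Flat ⊓ @QuasiCompact) hQ inferInstance
    have : Topology.IsClosedEmbedding g :=
      .of_continuous_injective_isClosedMap g.continuous g.injective g.isClosedMap
    have : IsAffineHom g :=
      isAffineHom_of_isInducing g this.isInducing this.isClosed_range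
    isAffine_of_isAffineHom g
  wlog hY : ∃ T, Y = Spec T generalizing Y
  · rw [← cancel_left_of_respectsIso @IsClosedImmersion Y.isoSpec.inv]
    have heq : pullback.fst (Spec.map φ) (Y.isoSpec.inv ≫ g) =
      pullback.map _ _ _ _ (𝟙 _) (Y.isoSpec.inv) (𝟙 _) (by simp) (by simp) ≫
        pullback.fst (Spec.map φ) g := (pullback.lift_fst _ _ _).symm
    refine this _ ?_ inferInstance ⟨_, rfl⟩
    rwa [heq, cancel_left_of_respectsIso @IsClosedImmersion]
  obtain ⟨T, rfl⟩ := hY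
  refine of_pullback_fst_Spec_of_codescendsAlong (P := @IsClosedImmersion)
      (Q' := RingHom.FaithfullyFlat) (Q := fun f ↦ Function.Surjective f)
      (P' := @Surjective ⊓ @Flat)
      RingHom.FaithfullyFlat.codescendsAlong_surjective ?_ ?_ h hfst
  · intro _ _ f hf
    rw [← flat_and_surjective_SpecMap_iff, and_comm]
    exact hf
  · intro A B f
    refine ⟨fun hf ↦ ?_, fun hf ↦ IsClosedImmersion.spec_of_surjective f hf⟩
    have := (IsClosedImmersion.isAffine_surjective_of_isAffine (Spec.map f)).2
    have e := Scheme.ΓSpecIso_inv_naturality f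
    have h2 : Function.Surjective
        (f ≫ (Scheme.ΓSpecIso B).inv) := by
      rw [e]
      exact this.comp (ConcreteCategory.bijective_of_isIso (Scheme.ΓSpecIso A).inv).2
    intro b
    obtain ⟨a, ha⟩ := h2 ((Scheme.ΓSpecIso B).inv b)
    exact ⟨a, (ConcreteCategory.bijective_of_isIso (Scheme.ΓSpecIso B).inv).1 ha⟩

/-- If the base change of an `R`-morphism of schemes along a faithfully flat ring map `R → R'`
is a closed immersion, then so is the original morphism. -/
theorem isClosedImmersion_of_faithfullyFlat_baseChange
    {R R' : Type u} [CommRing R] [CommRing R'] [Algebra R R']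
    (hflat : Module.Flat R R')
    (hsurj : Function.Surjective (PrimeSpectrum.comap (algebraMap R R')))
    {X Y : Scheme.{u}} (sX : X ⟶ Spec (CommRingCat.of R)) (sY : Y ⟶ Spec (CommRingCat.of R))
    (f : X ⟶ Y) (hf : f ≫ sY = sX)
    (hf' : IsClosedImmersion
      (pullback.map sX (Spec.map (CommRingCat.ofHom (algebraMap R R')))
        sY (Spec.map (CommRingCat.ofHom (algebraMap R R'))) f (𝟙 _) (𝟙 _)
        (by rw [Category.comp_id, ← hf]) (by simp))) :
    IsClosedImmersion f := by
  subst hf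
  set p := Spec.map (CommRingCat.ofHom (algebraMap R R')) with hp
  have hff : Flat p ∧ Surjective p := by
    rw [hp, flat_and_surjective_SpecMap_iff, RingHom.FaithfullyFlat.iff_flat_and_comap_surjective]
    exact ⟨RingHom.flat_algebraMap_iff.mpr hflat, hsurj⟩
  obtain ⟨h1, h2⟩ := hff
  have hpb : IsPullback (pullback.map (f ≫ sY) p sY p f (𝟙 _) (𝟙 _) (by simp) (by simp))
      (pullback.fst (f ≫ sY) p) (pullback.fst sY p) f := by
    refine IsPullback.of_right (h₁₂ := pullback.snd sY p) (h₂₂ := sY) (v₁₃ := p) ?_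
      (pullback.lift_fst _ _ _)
      (IsPullback.of_hasPullback sY p).flip
    have e : pullback.map (f ≫ sY) p sY p f (𝟙 _) (𝟙 _) (by simp) (by simp) ≫
        pullback.snd sY p = pullback.snd (f ≫ sY) p :=
      (pullback.lift_snd _ _ _).trans (Category.comp_id _)
    rw [e]
    exact (IsPullback.of_hasPullback (f ≫ sY) p).flip
  have := closedImmersion_descendsAlong_aux.{u}
  exact MorphismProperty.of_isPullback_of_descendsAlong (P := @IsClosedImmersion)
    (Q := @Surjective ⊓ @Flat ⊓ @QuasiCompact) hpb
    ⟨⟨inferInstance, inferInstance⟩, inferInstance⟩ hf'
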